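/- arXiv:2306.11281 — 3 statements merged into one kernel-verified Lean document; each statement's English description precedes it below -/
import Mathlib

section
/- Let μ be a probability measure on ℝ^m that admits a density with respect to Lebesgue measure which is continuous and strictly positive everywhere. Then there exists a Borel measurable bijective autoregressive map f : ℝ^m → ℝ^m such that the pushforward of the standard Gaussian measure γ under f equals μ. -/
open MeasureTheory ProbabilityTheory

/-- A map `f : ℝ^m → ℝ^m` is autoregressive if each output coordinate depends only on the
input coordinates with index at most its own. -/
def Autoregressive (m : ℕ) (f : (Fin m → ℝ) → Fin m → ℝ) : Prop :=
  ∀ (j : Fin m) (x y : Fin m → ℝ), (∀ i, i ≤ j → x i = y i) → f x j = f y j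

/-- The standard Gaussian measure on `ℝ^m`: the `m`-fold product of `N(0,1)`. -/
noncomputable def stdGaussian (m : ℕ) : Measure (Fin m → ℝ) :=
  Measure.pi fun _ : Fin m => gaussianReal 0 1

lemma cdf_good (ν : Measure ℝ) [IsProbabilityMeasure ν] [NullSingletonClass ν] [ν.IsOpenPosMeasure] :
    StrictMono (cdf ν) ∧ Continuous (cdf ν) ∧ Set.range (cdf ν) = Set.Ioo 0 1 := by
  have hs : StrictMono (cdf ν) := by
    intro a b hab
    have h1 : 0 < ν (Set.Ioc a b) := by
      refine lt_of_lt_of_le ?_ (measure_mono Set.Ioo_subset_Ioc_self)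
      exact isOpen_Ioo.measure_pos ν (Set.nonempty_Ioo.2 hab)
    rw [← measure_cdf ν, StieltjesFunction.measure_Ioc] at h1
    have := ENNReal.ofReal_pos.1 h1
    linarith
  have hc : Continuous (cdf ν) := by
    rw [continuous_iff_continuousAt]
    intro x
    have h0 : ν {x} = 0 := measure_singleton x
    rw [← measure_cdf ν, StieltjesFunction.measure_singleton] at h0
    have h1 := ENNReal.ofReal_eq_zero.1 h0
    have h2 := (cdf ν).mono.leftLim_le (le_refl x)
    rw [(cdf ν).mono.continuousAt_iff_leftLim_eq_rightLim]
    rw [(cdf ν).rightLim_eq]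
    linarith
  refine ⟨hs, hc, ?_⟩
  ext p
  constructor
  · rintro ⟨x, rfl⟩
    exact ⟨(cdf_nonneg ν (x-1)).trans_lt (hs (by linarith)),
      (hs (by linarith : x < x + 1)).trans_le (cdf_le_one ν _)⟩
  · rintro ⟨h0, h1⟩
    exact mem_range_of_exists_le_of_exists_ge hc
      (((tendsto_cdf_atBot ν).eventually_le_const h0).exists)
      (((tendsto_cdf_atTop ν).eventually_const_le h1).exists)

lemma one_dim (γ ν : Measure ℝ) [IsProbabilityMeasure ν] [NullSingletonClass ν] [ν.IsOpenPosMeasure]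
    [IsProbabilityMeasure γ] [NullSingletonClass γ] [γ.IsOpenPosMeasure] :
    ∃ T : ℝ → ℝ, Function.Bijective T ∧ (∀ t c, T t ≤ c ↔ cdf γ t ≤ cdf ν c) ∧
      Measurable T ∧ γ.map T = ν := by
  obtain ⟨hs, hc, hr⟩ := cdf_good ν
  obtain ⟨gs, gc, gr⟩ := cdf_good γ
  have ex : ∀ t, ∃ s, cdf ν s = cdf γ t := fun t => by
    have : cdf γ t ∈ Set.range (cdf γ) := ⟨t, rfl⟩
    rw [gr, ← hr] at this
    exact this
  have ex' : ∀ t, ∃ s, cdf γ s = cdf ν t := fun t => by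
    have : cdf ν t ∈ Set.range (cdf ν) := ⟨t, rfl⟩
    rw [hr, ← gr] at this
    exact this
  choose T hT using ex
  have hle : ∀ t c, T t ≤ c ↔ cdf γ t ≤ cdf ν c := fun t c => by
    rw [← hT, hs.le_iff_le]
  have hm : Measurable T := by
    apply measurable_of_Iic
    intro c
    have : T ⁻¹' Set.Iic c = {t | cdf γ t ≤ cdf ν c} := by ext t; exact hle t c
    rw [this]
    exact measurableSet_le gc.measurable measurable_const
  refine ⟨T, ⟨fun a b h => gs.injective (by rw [← hT, ← hT, h]), fun s => ?_⟩, hle, hm, ?_⟩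
  · obtain ⟨t, ht⟩ := ex' s
    exact ⟨t, hs.injective (by rw [hT, ht])⟩
  · have : IsProbabilityMeasure (γ.map T) := Measure.isProbabilityMeasure_map hm.aemeasurable
    apply Measure.ext_of_Iic
    intro c
    obtain ⟨d, hd⟩ := ex' c
    rw [Measure.map_apply hm measurableSet_Iic]
    have : T ⁻¹' Set.Iic c = Set.Iic d := by
      ext t
      simp only [Set.mem_preimage, Set.mem_Iic, hle, ← hd, gs.le_iff_le]
    rw [this, ← ofReal_cdf, ← ofReal_cdf, hd]

instance gauss_pos : (gaussianReal 0 1).IsOpenPosMeasure :=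
  (gaussianReal_absolutelyContinuous' 0 one_ne_zero).isOpenPosMeasure

lemma pos_of_withDensity {β : Type*} [MeasurableSpace β] (ν : Measure β) (r : β → ENNReal)
    (hr : Measurable r) (hp : ∀ x, 0 < r x) : ν ≪ ν.withDensity r :=
  withDensity_absolutelyContinuous' hr.aemeasurable (Filter.Eventually.of_forall fun x => (hp x).ne')

lemma step {α : Type*} [MeasurableSpace α] (lam : Measure α) [SigmaFinite lam]
    (μ : Measure (α × ℝ)) [IsProbabilityMeasure μ] (ρ : α × ℝ → ENNReal) (hρ : Measurable ρ)
    (hp : ∀ x, 0 < ρ x) (hμ : μ = (lam.prod volume).withDensity ρ)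
    (ρ' : α → ENNReal) (hρ'def : ρ' = fun y => ∫⁻ t, ρ (y, t)) :
    Measurable ρ' ∧ (∀ y, 0 < ρ' y) ∧ IsProbabilityMeasure (lam.withDensity ρ') ∧
    ∃ T : α → ℝ → ℝ, Measurable (fun p : α × ℝ => T p.1 p.2) ∧
      (∀ y, Function.Bijective (T y)) ∧
      ((lam.withDensity ρ').prod (gaussianReal 0 1)).map (fun p => (p.1, T p.1 p.2)) = μ := by
  have hm' : Measurable ρ' := by rw [hρ'def]; exact hρ.lintegral_prod_right'
  have hsec : ∀ y, Measurable fun t => ρ (y, t) := fun y => hρ.comp measurable_prodMk_left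
  have hpos : ∀ y, 0 < ρ' y := fun y => by
    rw [hρ'def]
    dsimp only
    rw [lintegral_pos_iff_support (hsec y)]
    have : (Function.support fun t => ρ (y, t)) = Set.univ := by
      ext t; simpa using (hp (y, t)).ne'
    rw [this]; simp
  have htot : ∫⁻ y, ρ' y ∂lam = 1 := by
    have : μ Set.univ = 1 := measure_univ
    rw [hμ, withDensity_apply _ MeasurableSet.univ, Measure.restrict_univ,
      lintegral_prod _ hρ.aemeasurable] at this
    rw [hρ'def]; exact this
  have hfin : ∀ᵐ y ∂lam, ρ' y < ⊤ := ae_lt_top hm' (by rw [htot]; simp)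
  have hprob : IsProbabilityMeasure (lam.withDensity ρ') :=
    ⟨by rw [withDensity_apply _ MeasurableSet.univ, Measure.restrict_univ, htot]⟩
  refine ⟨hm', hpos, hprob, ?_⟩
  classical
  let κ : α → Measure ℝ := fun y => if ρ' y = ⊤ then gaussianReal 0 1 else
    (ρ' y)⁻¹ • (volume.withDensity fun t => ρ (y, t))
  have hκ1 : ∀ y, ρ' y = ⊤ → κ y = gaussianReal 0 1 := fun y h => if_pos h
  have hκ2 : ∀ y, ρ' y ≠ ⊤ → κ y = (ρ' y)⁻¹ • (volume.withDensity fun t => ρ (y, t)) :=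
    fun y h => if_neg h
  have hκP : ∀ y, IsProbabilityMeasure (κ y) := by
    intro y
    by_cases h : ρ' y = ⊤
    · rw [hκ1 y h]; infer_instance
    · constructor
      rw [hκ2 y h, Measure.smul_apply, withDensity_apply _ MeasurableSet.univ,
        Measure.restrict_univ, smul_eq_mul]
      have : ∫⁻ t, ρ (y, t) = ρ' y := by rw [hρ'def]
      rw [this]
      exact ENNReal.inv_mul_cancel (hpos y).ne' h
  have hκm : ∀ c, Measurable fun y => cdf (κ y) c := by
    intro c
    have h1 : Measurable fun y => (κ y) (Set.Iic c) := by
      have h2 : (fun y => (κ y) (Set.Iic c)) = fun y => if ρ' y = ⊤ then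
          gaussianReal 0 1 (Set.Iic c) else
          (ρ' y)⁻¹ * ∫⁻ t, ρ (y, t) ∂(volume.restrict (Set.Iic c)) := by
        funext y
        by_cases h : ρ' y = ⊤
        · rw [hκ1 y h, if_pos h]
        · rw [hκ2 y h, if_neg h, Measure.smul_apply, withDensity_apply _ measurableSet_Iic,
            smul_eq_mul]
      rw [h2]
      exact Measurable.ite (hm' (measurableSet_singleton ⊤)) measurable_const
        (hm'.inv.mul hρ.lintegral_prod_right')
    have h3 : (fun y => cdf (κ y) c) = fun y => ((κ y) (Set.Iic c)).toReal := by
      funext y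
      have := hκP y
      rw [cdf_eq_real]; rfl
    rw [h3]
    exact h1.ennreal_toReal
  have hex : ∀ y, ∃ T : ℝ → ℝ, Function.Bijective T ∧
      (∀ t c, T t ≤ c ↔ cdf (gaussianReal 0 1) t ≤ cdf (κ y) c) ∧
      Measurable T ∧ (gaussianReal 0 1).map T = κ y := by
    intro y
    by_cases h : ρ' y = ⊤
    · rw [hκ1 y h]
      have := nullSingletonClass_gaussianReal (μ := 0) (v := 1) one_ne_zero
      exact one_dim _ _
    · have := nullSingletonClass_gaussianReal (μ := 0) (v := 1) one_ne_zero
      have i1 := hκP y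
      have i2 : NullSingletonClass (κ y) := by
        constructor
        intro x
        rw [hκ2 y h, Measure.smul_apply, measure_singleton]
        simp
      have i3 : (κ y).IsOpenPosMeasure := by
        refine Measure.AbsolutelyContinuous.isOpenPosMeasure (μ := volume) ?_
        rw [hκ2 y h]
        refine (pos_of_withDensity volume _ (hsec y) fun t => hp (y, t)).trans ?_
        exact Measure.absolutelyContinuous_smul (ENNReal.inv_ne_zero.2 h)
      exact one_dim _ _
  choose T hT using hex
  have hTm : Measurable (fun p : α × ℝ => T p.1 p.2) := by
    apply measurable_of_Iic
    intro c
    have : (fun p : α × ℝ => T p.1 p.2) ⁻¹' Set.Iic c =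
      {p | cdf (gaussianReal 0 1) p.2 ≤ cdf (κ p.1) c} := by
        ext p; exact (hT p.1).2.1 p.2 c
    rw [this]
    exact measurableSet_le ((cdf (gaussianReal 0 1)).mono.measurable.comp measurable_snd)
      ((hκm c).comp measurable_fst)
  refine ⟨T, hTm, fun y => (hT y).1, ?_⟩
  have hFm : Measurable (fun p : α × ℝ => (p.1, T p.1 p.2)) := measurable_fst.prodMk hTm
  ext s hs
  rw [Measure.map_apply hFm hs, Measure.prod_apply (hFm hs), hμ, withDensity_apply _ hs,
    ← lintegral_indicator hs, lintegral_prod _ (hρ.indicator hs).aemeasurable,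
    lintegral_withDensity_eq_lintegral_mul _ hm' (measurable_measure_prodMk_left (hFm hs))]
  apply lintegral_congr_ae
  filter_upwards [hfin] with y hy
  have e1 : Prod.mk y ⁻¹' ((fun p : α × ℝ => (p.1, T p.1 p.2)) ⁻¹' s) =
      T y ⁻¹' (Prod.mk y ⁻¹' s) := rfl
  have hs' : MeasurableSet (Prod.mk y ⁻¹' s) := measurable_prodMk_left hs
  simp only [Pi.mul_apply]
  rw [e1, ← Measure.map_apply (hT y).2.2.1 hs', (hT y).2.2.2, hκ2 y hy.ne, Measure.smul_apply,
    smul_eq_mul, ← mul_assoc, ENNReal.mul_inv_cancel (hpos y).ne' hy.ne, one_mul,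
    withDensity_apply _ hs', ← lintegral_indicator hs']
  rfl

lemma main_ind (m : ℕ) : ∀ (μ : Measure (Fin m → ℝ)) [IsProbabilityMeasure μ]
    (ρ : (Fin m → ℝ) → ENNReal) (_ : Measurable ρ) (_ : ∀ x, 0 < ρ x)
    (_ : μ = volume.withDensity ρ),
    ∃ f : (Fin m → ℝ) → Fin m → ℝ,
      Measurable f ∧ Function.Bijective f ∧ Autoregressive m f ∧
      (_root_.stdGaussian m).map f = μ := by
  induction m with
  | zero =>
    intro μ _ ρ _ _ _
    refine ⟨id, measurable_id, Function.bijective_id, fun j => j.elim0, ?_⟩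
    rw [Measure.map_id]
    have : IsProbabilityMeasure (_root_.stdGaussian 0) := by unfold _root_.stdGaussian; infer_instance
    ext s hs
    rcases Set.eq_empty_or_nonempty s with h | h
    · simp [h]
    · rw [Subsingleton.eq_univ_of_nonempty h]; simp
  | succ m ih =>
    intro μ _ ρ hρ hp hμ
    let e : (Fin (m+1) → ℝ) ≃ᵐ (Fin m → ℝ) × ℝ :=
      (MeasurableEquiv.piFinSuccAbove (fun _ => ℝ) (Fin.last m)).trans MeasurableEquiv.prodComm
    have he1 : ∀ x, (e x).2 = x (Fin.last m) := fun x => rfl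
    have he2 : ∀ x i, (e x).1 i = x i.castSucc := fun x i => by
      change x ((Fin.last m).succAbove i) = x i.castSucc
      rw [Fin.succAbove_last]
    have hv : MeasurePreserving e volume (volume.prod volume) :=
      Measure.measurePreserving_swap.comp
        (volume_preserving_piFinSuccAbove (fun _ => ℝ) (Fin.last m))
    have : SFinite (_root_.stdGaussian m) := by unfold _root_.stdGaussian; infer_instance
    have hg : MeasurePreserving e (_root_.stdGaussian (m+1)) ((_root_.stdGaussian m).prod (gaussianReal 0 1)) :=
      Measure.measurePreserving_swap.comp
        (measurePreserving_piFinSuccAbove (fun _ => gaussianReal 0 1) (Fin.last m))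
    have : IsProbabilityMeasure (μ.map e) :=
      Measure.isProbabilityMeasure_map e.measurable.aemeasurable
    have hμe : μ.map e = (volume.prod volume).withDensity (ρ ∘ e.symm) := by
      ext s hs
      rw [Measure.map_apply e.measurable hs, hμ, withDensity_apply _ (e.measurable hs),
        withDensity_apply _ hs, ← hv.setLIntegral_comp_preimage hs (hρ.comp e.symm.measurable)]
      simp
    obtain ⟨hm', hpos, hprob, T, hTm, hTb, hTmap⟩ := step volume (μ.map e) (ρ ∘ e.symm)
      (hρ.comp e.symm.measurable) (fun x => hp _) hμe _ rfl
    obtain ⟨f, hf, hfb, hfa, hfm⟩ := ih _ _ hm' hpos rfl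
    let A : (Fin m → ℝ) × ℝ → (Fin m → ℝ) × ℝ := Prod.map f id
    let B : (Fin m → ℝ) × ℝ → (Fin m → ℝ) × ℝ := fun p => (p.1, T p.1 p.2)
    have hA : Measurable A := hf.prodMap measurable_id
    have hB : Measurable B := measurable_fst.prodMk hTm
    have hAb : Function.Bijective A := hfb.prodMap Function.bijective_id
    have hBb : Function.Bijective B := by
      constructor
      · rintro ⟨a, b⟩ ⟨c, d⟩ h
        simp only [B, Prod.mk.injEq] at h
        obtain ⟨rfl, h⟩ := h
        rw [(hTb a).1 h]
      · rintro ⟨a, b⟩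
        obtain ⟨t, ht⟩ := (hTb a).2 b
        exact ⟨(a, t), by simp [B, ht]⟩
    refine ⟨fun x => e.symm (B (A (e x))),
      e.symm.measurable.comp (hB.comp (hA.comp e.measurable)),
      e.symm.bijective.comp (hBb.comp (hAb.comp e.bijective)), ?_, ?_⟩
    · intro j x y hxy
      set X := e.symm (B (A (e x))) with hX
      set Y := e.symm (B (A (e y))) with hY
      have hX' : e X = B (A (e x)) := by simp [hX]
      have hY' : e Y = B (A (e y)) := by simp [hY]
      refine Fin.lastCases (motive := fun j => (∀ i, i ≤ j → x i = y i) → X j = Y j) ?_ ?_ j hxy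
      · intro h
        have : x = y := funext fun i => h i (Fin.le_last i)
        rw [hX, hY, this]
      · intro i h
        rw [← he2 X, ← he2 Y, hX', hY']
        change f (e x).1 i = f (e y).1 i
        apply hfa
        intro k hk
        rw [he2, he2]
        exact h _ (by simpa using hk)
    · have h1 : ((_root_.stdGaussian m).prod (gaussianReal 0 1)).map A =
          (volume.withDensity fun y => ∫⁻ t, (ρ ∘ e.symm) (y, t)).prod (gaussianReal 0 1) := by
        rw [← hfm]
        have := Measure.map_prod_map (_root_.stdGaussian m) (gaussianReal 0 1) hf measurable_id
        rw [Measure.map_id] at this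
        exact this.symm
      have h2 : (_root_.stdGaussian (m+1)).map (fun x => e.symm (B (A (e x)))) =
          ((((_root_.stdGaussian (m+1)).map e).map A).map B).map e.symm := by
        rw [Measure.map_map hA e.measurable, Measure.map_map hB (hA.comp e.measurable),
          Measure.map_map e.symm.measurable (hB.comp (hA.comp e.measurable))]
        rfl
      rw [h2, hg.map_eq, h1, hTmap, Measure.map_map e.symm.measurable e.measurable]
      simp

/-- If `μ` is a probability measure on `ℝ^m` with an everywhere continuous and strictly
positive density with respect to Lebesgue measure, then there exists a Borel measurable
bijective autoregressive map `f` pushing the standard Gaussian forward to `μ`. -/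
theorem stmt3 (m : ℕ) (μ : Measure (Fin m → ℝ)) [IsProbabilityMeasure μ]
    (ρ : (Fin m → ℝ) → ℝ) (hρc : Continuous ρ) (hρpos : ∀ x, 0 < ρ x)
    (hμ : μ = volume.withDensity fun x => ENNReal.ofReal (ρ x)) :
    ∃ f : (Fin m → ℝ) → Fin m → ℝ,
      Measurable f ∧ Function.Bijective f ∧ Autoregressive m f ∧
      (stdGaussian m).map f = μ := by
  refine main_ind m μ _ (hρc.measurable.ennreal_ofReal) (fun x => ?_) hμ
  exact ENNReal.ofReal_pos.2 (hρpos x)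
end

section
/- Let f, f' : ℝ^m → ℝ^m be bijective autoregressive maps and let 1 ≤ j ≤ m. Then the causal mechanisms of f and f' at coordinate j are equal as functions (f̂_j = f̂'_j) if and only if the j-th coordinate functions of the inverses agree everywhere, i.e., (f⁻¹ x)_j = ((f')⁻¹ x)_j for all x ∈ ℝ^m. -/
theorem exists_w (m : ℕ) (f finv : (Fin m → ℝ) → Fin m → ℝ) (hauto : Autoregressive m f)
    (hr : Function.RightInverse finv f) (j : Fin m) (z : Fin j.val → ℝ) :
    ∃ u : Fin m → ℝ, ∀ e : ℝ,
      (fun i => f (Function.update u j e) (Fin.castLE j.isLt.le i)) = z := by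
  refine ⟨finv (fun i => if h : i.val < j.val then z ⟨i.val, h⟩ else 0), fun e => ?_⟩
  funext i
  have hi : Fin.castLE j.isLt.le i < j := by
    rw [Fin.lt_def]; exact i.isLt
  rw [hauto _ _ (finv (fun i => if h : i.val < j.val then z ⟨i.val, h⟩ else 0)), hr]
  · simp
  · intro k hk
    exact Function.update_of_ne (ne_of_lt (lt_of_le_of_lt hk hi)) _ _

theorem mech_inj (m : ℕ) (f finv : (Fin m → ℝ) → Fin m → ℝ)
    (hinj : Function.Injective f) (hauto : Autoregressive m f)
    (hr : Function.RightInverse finv f)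
    (fhat : (j : Fin m) → ℝ → (Fin j.val → ℝ) → ℝ)
    (hmech : ∀ (w : Fin m → ℝ) (j : Fin m),
      fhat j (w j) (fun i => f w (Fin.castLE j.isLt.le i)) = f w j)
    (j : Fin m) (z : Fin j.val → ℝ) (a b : ℝ) (h : fhat j a z = fhat j b z) : a = b := by
  obtain ⟨u, hu⟩ := exists_w m f finv hauto hr j z
  have key : ∀ n : ℕ, ∀ k : Fin m, k.val = n →
      f (Function.update u j a) k = f (Function.update u j b) k := by
    intro n
    induction n using Nat.strong_induction_on with
    | _ n ih =>
      intro k hk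
      by_cases hkj : k = j
      · subst hkj
        rw [← hmech, ← hmech (Function.update u k b), hu, hu]
        simpa using h
      · rw [← hmech, ← hmech (Function.update u j b), Function.update_of_ne hkj,
          Function.update_of_ne hkj]
        congr 1
        funext i
        exact ih i.val (by have := i.isLt; omega) _ rfl
  have := congrFun (hinj (funext fun k => key _ k rfl)) j
  simpa using this

/-- For bijective autoregressive maps `f, f'` with inverses `finv, finv'` and causal
mechanisms `fhat, fhat'` (characterized by
`f̂_j (w_j, ((f w)_1, …, (f w)_{j-1})) = (f w)_j` for all `w`), the mechanisms at
coordinate `j` coincide as functions iff the `j`-th coordinate functions of the inverses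
agree everywhere. -/
theorem stmt4 (m : ℕ) (f f' finv finv' : (Fin m → ℝ) → Fin m → ℝ)
    (hbij : Function.Bijective f) (hauto : Autoregressive m f)
    (hbij' : Function.Bijective f') (hauto' : Autoregressive m f')
    (hl : Function.LeftInverse finv f) (hr : Function.RightInverse finv f)
    (hl' : Function.LeftInverse finv' f') (hr' : Function.RightInverse finv' f')
    (fhat fhat' : (j : Fin m) → ℝ → (Fin j.val → ℝ) → ℝ)
    (hmech : ∀ (w : Fin m → ℝ) (j : Fin m),
      fhat j (w j) (fun i => f w (Fin.castLE j.isLt.le i)) = f w j)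
    (hmech' : ∀ (w : Fin m → ℝ) (j : Fin m),
      fhat' j (w j) (fun i => f' w (Fin.castLE j.isLt.le i)) = f' w j)
    (j : Fin m) :
    fhat j = fhat' j ↔ ∀ x : Fin m → ℝ, finv x j = finv' x j := by
  constructor
  · intro h x
    apply mech_inj m f finv hbij.1 hauto hr fhat hmech j
      (fun i => x (Fin.castLE j.isLt.le i))
    have h1 := hmech (finv x) j
    have h2 := hmech' (finv' x) j
    rw [hr] at h1
    rw [hr', ← h] at h2
    rw [h1, h2]
  · intro h
    funext e z
    obtain ⟨u, hu⟩ := exists_w m f finv hauto hr j z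
    have h1 := hmech (Function.update u j e) j
    have h2 := hmech' (finv' (f (Function.update u j e))) j
    rw [← h, hl, hr', hu] at h2
    rw [hu] at h1
    simp only [Function.update_self] at h1 h2
    rw [h1, h2]
end

section
/- Let (g,(f_d)_{d=1}^N) be an ILD with latent dimension m, observation space X, and f_1 = id. Let j ∈ I(F) and let j' > j be an index such that no index ĵ with j < ĵ ≤ j' belongs to I(F). Let h : ℝ^m → ℝ^m be the map that swaps coordinates j and j' (so h ∘ h = id), and define f'_d := h ∘ f_d ∘ h for each d and g' := g ∘ h⁻¹. Then: (i) every f'_d is a bijective autoregressive map and f'_1 = id, so (g',(f'_d)) is an ILD; (ii) (g',(f'_d)) is counterfactually equivalent to (g,(f_d)); and (iii) I(F') = (I(F) \ {j}) ∪ {j'}. -/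
/-- An invertible latent domain causal model (ILD). -/
structure ILD (m N : ℕ) (X : Type*) where
  g : (Fin m → ℝ) ≃ X
  f : Fin N → (Fin m → ℝ) ≃ (Fin m → ℝ)
  hauto : ∀ d, Autoregressive m (f d)

/-- Two ILDs are counterfactually equivalent if all their domain counterfactual maps agree. -/
def CFEquiv {m N : ℕ} {X : Type*} (M M' : ILD m N X) : Prop :=
  ∀ d d' : Fin N,
    (⇑M.g ∘ ⇑(M.f d') ∘ ⇑(M.f d).symm ∘ ⇑M.g.symm : X → X) =
      ⇑M'.g ∘ ⇑(M'.f d') ∘ ⇑(M'.f d).symm ∘ ⇑M'.g.symm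

/-- The intervention set of a family of bijective autoregressive maps. -/
def InterventionSet {m N : ℕ} (f : Fin N → (Fin m → ℝ) ≃ (Fin m → ℝ)) : Set (Fin m) :=
  {j | ∃ (d d' : Fin N) (x : Fin m → ℝ), (f d).symm x j ≠ (f d').symm x j}

/-- Swapping lemma: if `f_1 = id`, `j ∈ I(F)`, `j < j'`, and no index strictly between `j`
and `j'` (inclusive of `j'`) is intervened, then conjugating every latent SCM by the
coordinate swap `h` of `j` and `j'` (and replacing `g` by `g ∘ h⁻¹ = g ∘ h`) yields an ILD
(so every `h ∘ f_d ∘ h` is bijective autoregressive and `h ∘ f_1 ∘ h = id`) that is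
counterfactually equivalent to the original and whose intervention set is
`(I(F) \ {j}) ∪ {j'}`. -/
theorem stmt11 (m N : ℕ) (hN : 0 < N) (X : Type*) (M : ILD m N X)
    (h1 : M.f ⟨0, hN⟩ = Equiv.refl _)
    (j j' : Fin m) (hjI : j ∈ InterventionSet M.f) (hjj' : j < j')
    (hbetween : ∀ jj : Fin m, j < jj → jj ≤ j' → jj ∉ InterventionSet M.f)
    (h : (Fin m → ℝ) → Fin m → ℝ)
    (hdef : h = fun x i => x (Equiv.swap j j' i)) :
    (h ∘ h = id) ∧
    (∀ d, Function.Bijective (h ∘ ⇑(M.f d) ∘ h) ∧ Autoregressive m (h ∘ ⇑(M.f d) ∘ h)) ∧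
    (h ∘ ⇑(M.f ⟨0, hN⟩) ∘ h = id) ∧
    ∃ M' : ILD m N X,
      ⇑M'.g = ⇑M.g ∘ h ∧ (∀ d, ⇑(M'.f d) = h ∘ ⇑(M.f d) ∘ h) ∧
      M'.f ⟨0, hN⟩ = Equiv.refl _ ∧
      CFEquiv M M' ∧
      InterventionSet M'.f = (InterventionSet M.f \ {j}) ∪ {j'} := by
  have hh : ∀ x, h (h x) = x := by
    intro x; subst hdef; funext i; simp
  have hhx : ∀ x i, h x i = x (Equiv.swap j j' i) := by
    intro x i; rw [hdef]
  have hfix : ∀ jj : Fin m, j < jj → jj ≤ j' → ∀ d y, M.f d y jj = y jj := by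
    intro jj h2 h3 d y
    by_contra hne
    refine hbetween jj h2 h3 ⟨d, ⟨0, hN⟩, M.f d y, ?_⟩
    rw [h1]
    simpa using fun e => hne e.symm
  have hj'I : j' ∉ InterventionSet M.f := hbetween j' hjj' le_rfl
  have hA : ∀ d, Autoregressive m (h ∘ ⇑(M.f d) ∘ h) := by
    intro d i x y hxy
    simp only [Function.comp_apply]
    rw [hhx, hhx]
    by_cases hij : i = j
    · subst hij
      rw [Equiv.swap_apply_left, hfix _ hjj' le_rfl, hfix _ hjj' le_rfl, hhx, hhx,
        Equiv.swap_apply_right]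
      exact hxy _ le_rfl
    by_cases hij' : i = j'
    · subst hij'
      rw [Equiv.swap_apply_right]
      apply M.hauto d
      intro k hk
      rw [hhx, hhx]
      apply hxy
      rw [Equiv.swap_apply_def]
      split_ifs <;> order
    rw [Equiv.swap_apply_of_ne_of_ne hij hij']
    by_cases hb : j < i ∧ i ≤ j'
    · rw [hfix _ hb.1 hb.2, hfix _ hb.1 hb.2, hhx, hhx, Equiv.swap_apply_of_ne_of_ne hij hij']
      exact hxy _ le_rfl
    · apply M.hauto d
      intro k hk
      rw [hhx, hhx]
      apply hxy
      rw [Equiv.swap_apply_def]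
      rw [not_and_or, not_lt, not_le] at hb
      rcases hb with hb | hb <;> split_ifs <;> order
  let H : (Fin m → ℝ) ≃ (Fin m → ℝ) := ⟨h, h, hh, hh⟩
  have hid : h ∘ ⇑(M.f ⟨0, hN⟩) ∘ h = id := by
    rw [h1]; funext x; simp [hh]
  refine ⟨funext hh, fun d => ⟨(H.trans ((M.f d).trans H)).bijective, hA d⟩, hid,
    ⟨H.trans M.g, fun d => H.trans ((M.f d).trans H), hA⟩, rfl, fun d => rfl,
    DFunLike.coe_injective hid, ?_, ?_⟩
  · intro d d'
    funext x
    change _ = M.g (h (h (M.f d' (h (h ((M.f d).symm (h (h (M.g.symm x)))))))))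
    simp [hh]
  · have key : ∀ i, i ∈ InterventionSet (fun d => H.trans ((M.f d).trans H)) ↔
        Equiv.swap j j' i ∈ InterventionSet M.f := by
      intro i
      constructor
      · rintro ⟨d, d', x, hx⟩
        refine ⟨d, d', h x, ?_⟩
        have hx2 : h ((M.f d).symm (h x)) i ≠ h ((M.f d').symm (h x)) i := hx
        rw [hhx, hhx] at hx2
        exact hx2
      · rintro ⟨d, d', x, hx⟩
        refine ⟨d, d', h x, ?_⟩
        change h ((M.f d).symm (h (h x))) i ≠ h ((M.f d').symm (h (h x))) i
        rw [hh, hhx, hhx]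
        exact hx
    ext i
    rw [key]
    simp only [Set.mem_union, Set.mem_sdiff, Set.mem_singleton_iff]
    by_cases hij : i = j
    · subst hij
      simp [hj'I, hjj'.ne]
    by_cases hij' : i = j'
    · subst hij'
      simp [hjI]
    rw [Equiv.swap_apply_of_ne_of_ne hij hij']
    simp [hij, hij']
end
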